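/- arXiv:1111.6422 — 3 statements merged into one kernel-verified Lean document; each statement's English description precedes it below -/
import Mathlib

section
/- For integers M ≥ 0 and N ≥ 0, the generating function of partitions with distinct parts having exactly N parts, all parts at most M, is: Σ_{λ distinct-part partition, l(λ)=N, λ_1 ≤ M} q^{|λ|} = q^{N(N+1)/2} · [M,N]_q, as an identity of polynomials in q (in particular both sides are 0 if N > M). -/
open PowerSeries

noncomputable section

/-- The product (coefficientwise) topology on `ℚ⟦X⟧`. -/
instance : TopologicalSpace ℚ⟦X⟧ :=
  inferInstanceAs (TopologicalSpace ((Unit →₀ ℕ) → ℚ))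

/-- `(q)_n = ∏_{i=1}^n (1 - q^i)` in `ℚ⟦X⟧`. -/
def qp (n : ℕ) : ℚ⟦X⟧ := ∏ i ∈ Finset.range n, (1 - X ^ (i + 1))

/-- `(-q)_n = ∏_{i=1}^n (1 + q^i)` in `ℚ⟦X⟧`. -/
def nqp (n : ℕ) : ℚ⟦X⟧ := ∏ i ∈ Finset.range n, (1 + X ^ (i + 1))

/-- The Gaussian binomial `[M, N]_q`, zero unless `M ≥ N`. -/
def qbinom (M N : ℕ) : ℚ⟦X⟧ :=
  if N ≤ M then qp M * ((qp N)⁻¹ * (qp (M - N))⁻¹) else 0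

/-- Weakly decreasing tuples `f 0 ≥ f 1 ≥ … ≥ f (r-1) ≥ 0`, encoded as
antitone functions `ℕ → ℕ` vanishing from index `r` on. -/
def DecTuple (r : ℕ) : Type :=
  {f : ℕ → ℕ // (∀ ⦃i j : ℕ⦄, i ≤ j → f j ≤ f i) ∧ ∀ i, r ≤ i → f i = 0}

/-- `(q)_λ = (q)_{λ_1-λ_2} ⋯ (q)_{λ_{r-1}-λ_r} (q)_{λ_r}` for a weakly
decreasing tuple `λ` (0-indexed). -/
def qpT (r : ℕ) (f : ℕ → ℕ) : ℚ⟦X⟧ := ∏ i ∈ Finset.range r, qp (f i - f (i + 1))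


lemma qp_succ (n : ℕ) : qp (n + 1) = qp n * (1 - X ^ (n + 1)) := by
  simp [qp, Finset.prod_range_succ]

lemma constantCoeff_qp (n : ℕ) : constantCoeff (qp n) = 1 := by
  simp [qp, map_prod]

lemma qp_mul_inv (n : ℕ) : qp n * (qp n)⁻¹ = 1 :=
  PowerSeries.mul_inv_cancel _ (by simp [constantCoeff_qp])

lemma qp_inv_eq (n : ℕ) : (qp n)⁻¹ = (1 - X ^ (n + 1)) * (qp (n + 1))⁻¹ := by
  have h := qp_mul_inv (n + 1)
  rw [qp_succ] at h ⊢
  linear_combination (-(qp n)⁻¹) * h +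
    (1 - X ^ (n + 1)) * (qp n * (1 - X ^ (n + 1)))⁻¹ * qp_mul_inv n

lemma qbinom_zero_right (M : ℕ) : qbinom M 0 = 1 := by
  have h : (qp 0)⁻¹ = 1 := by simp [qp]
  simp [qbinom, h, qp_mul_inv]

lemma qbinom_self (N : ℕ) : qbinom N N = 1 := by
  have h : (qp 0)⁻¹ = 1 := by simp [qp]
  simp [qbinom, h, qp_mul_inv]

lemma qbinom_eq_zero {M N : ℕ} (h : M < N) : qbinom M N = 0 := by
  simp [qbinom, h]

/-- The `q`-Pascal recurrence. -/
lemma qbinom_succ_succ (M N : ℕ) :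
    qbinom (M + 1) (N + 1) = qbinom M (N + 1) + X ^ (M - N) * qbinom M N := by
  rcases lt_trichotomy M N with h | rfl | h
  · simp [qbinom_eq_zero, h, Nat.lt_succ_of_lt h]
  · simp [qbinom_self, qbinom_eq_zero]
  · obtain ⟨k, rfl⟩ := Nat.exists_eq_add_of_lt h
    have e₁ : N + k + 1 + 1 - (N + 1) = k + 1 := by omega
    have e₂ : N + k + 1 - (N + 1) = k := by omega
    have e₃ : N + k + 1 - N = k + 1 := by omega
    rw [qbinom, qbinom, qbinom, if_pos (by omega), if_pos (by omega), if_pos (by omega),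
      e₁, e₂, e₃, qp_succ (N + k + 1), qp_inv_eq N, qp_inv_eq k]
    ring

lemma sum_powersetCard_Icc_succ (M N : ℕ) :
    ∑ s ∈ (Finset.Icc 1 (M + 1)).powersetCard (N + 1), (X : ℚ⟦X⟧) ^ s.sum id =
      ∑ s ∈ (Finset.Icc 1 M).powersetCard (N + 1), (X : ℚ⟦X⟧) ^ s.sum id +
        X ^ (M + 1) * ∑ s ∈ (Finset.Icc 1 M).powersetCard N, (X : ℚ⟦X⟧) ^ s.sum id := by
  have hM : M + 1 ∉ Finset.Icc 1 M := by simp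
  have hmem {n : ℕ} {s : Finset ℕ} (hs : s ∈ (Finset.Icc 1 M).powersetCard n) : M + 1 ∉ s :=
    fun h => hM ((Finset.mem_powersetCard.1 hs).1 h)
  rw [← Finset.insert_Icc_right_eq_Icc_add_one (by omega : 1 ≤ M + 1),
    Finset.powersetCard_succ_insert hM, Finset.sum_union, Finset.sum_image, Finset.mul_sum]
  · congr 1
    refine Finset.sum_congr rfl fun s hs => ?_
    rw [Finset.sum_insert (hmem hs), pow_add, id]
  · intro s hs t ht h
    rw [← Finset.erase_insert (hmem hs), ← Finset.erase_insert (hmem ht)]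
    exact congrArg (fun u => Finset.erase u (M + 1)) h
  · refine Finset.disjoint_left.2 fun s hs ht => hmem hs ?_
    obtain ⟨t, -, rfl⟩ := Finset.mem_image.1 ht
    exact Finset.mem_insert_self _ _

lemma sum_powersetCard_Icc (M N : ℕ) :
    ∑ s ∈ (Finset.Icc 1 M).powersetCard N, (X : ℚ⟦X⟧) ^ s.sum id =
      (X : ℚ⟦X⟧) ^ (N * (N + 1) / 2) * qbinom M N := by
  induction M generalizing N with
  | zero =>
    cases N with
    | zero => simp [qbinom_zero_right]
    | succ N =>
      rw [Finset.powersetCard_eq_empty.2 (by simp)]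
      simp [qbinom_eq_zero]
  | succ M ih =>
    cases N with
    | zero => simp [qbinom_zero_right]
    | succ N =>
      have e : (N + 1) * (N + 1 + 1) / 2 = N * (N + 1) / 2 + (N + 1) := by
        rw [show (N + 1) * (N + 1 + 1) = N * (N + 1) + (N + 1) * 2 by ring,
          Nat.add_mul_div_right _ _ two_pos]
      rw [sum_powersetCard_Icc_succ, ih, ih, qbinom_succ_succ, e]
      rcases lt_or_ge M N with h | h
      · simp [qbinom_eq_zero h]
      · obtain ⟨k, rfl⟩ := Nat.exists_eq_add_of_le h
        rw [Nat.add_sub_cancel_left]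
        ring

/-- The generating function of distinct-part partitions with exactly `N` parts,
all parts at most `M` (such a partition being encoded as its `N`-element set of
parts inside `[1, M]`), is `q^{N(N+1)/2}·[M,N]_q`. -/
theorem stmt1 (M N : ℕ) :
    ∑ s ∈ (Finset.Icc 1 M).powerset.filter (fun s => s.card = N),
        (X : ℚ⟦X⟧) ^ s.sum id =
      (X : ℚ⟦X⟧) ^ (N * (N + 1) / 2) * qbinom M N := by
  rw [← Finset.powersetCard_eq_filter, sum_powersetCard_Icc]
end
end

section
/- For integers r ≥ 1 and 0 ≤ m ≤ r−1, setting m' = min(m, r−m), the following identity holds in ℚ[[q]]: Σ_{λ_1 ≥ … ≥ λ_r ≥ 0} (q^{Σ_{i=1}^r λ_i(λ_i+1)/2} / (q)_λ) · (1 + Σ_{i=0}^{m−1} q^{Σ_{j=0}^{i} (λ_{r−m+j} + 1)}) = Σ_{λ_1 ≥ … ≥ λ_r ≥ 0} (q^{Σ_{i=1}^r λ_i(λ_i+1)/2} / (q)_λ) · (1 + Σ_{i=0}^{m'−1} q^{Σ_{j=0}^{i} (λ_{r−1−2j} + 1)}). -/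
open PowerSeries

noncomputable section

/-- The indicator function of the interval `[a, b)`. -/
def intervalVec (a b : ℕ) : ℕ → ℕ := fun t => if a ≤ t ∧ t < b then 1 else 0

/-- The summand of `fermionic`. -/
def fermionicTerm (r : ℕ) (v f : ℕ → ℕ) : ℚ⟦X⟧ :=
  X ^ (∑ i ∈ Finset.range r, f i * (f i + 1) / 2) * (qpT r f)⁻¹ *
    X ^ (∑ i ∈ Finset.range r, v i * (f i + 1))

/-- The fermionic sum with linear term `∑ v_i (λ_i + 1)` in the exponent. -/
def fermionic (r : ℕ) (v : ℕ → ℕ) : ℚ⟦X⟧ := ∑' f : DecTuple r, fermionicTerm r v f.1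

instance : T2Space ℚ⟦X⟧ := inferInstanceAs (T2Space ((Unit →₀ ℕ) → ℚ))

instance : IsTopologicalRing ℚ⟦X⟧ := PowerSeries.WithPiTopology.instIsTopologicalRing ℚ

lemma finite_decTuple_le (r d : ℕ) : {f : DecTuple r | ∀ i < r, f.1 i ≤ d}.Finite := by
  refine Set.Finite.of_finite_image (f := fun f : DecTuple r => fun i : Fin r => f.1 i) ?_ ?_
  · refine (Set.finite_Iic (fun _ : Fin r => d)).subset ?_
    rintro _ ⟨f, hf, rfl⟩ i
    exact hf i i.2
  · intro f _ g _ h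
    apply Subtype.ext
    funext i
    by_cases hi : i < r
    · exact congrFun h ⟨i, hi⟩
    · rw [f.2.2 i (by omega), g.2.2 i (by omega)]

lemma summable_fermionicTerm (r : ℕ) (v : ℕ → ℕ) :
    Summable fun f : DecTuple r => fermionicTerm r v f.1 := by
  refine Pi.summable (f := fun f : DecTuple r => (fermionicTerm r v f.1 : (Unit →₀ ℕ) → ℚ)).2
    fun s => ?_
  obtain ⟨d, rfl⟩ : ∃ d, s = Finsupp.single () d := ⟨s (), by ext; simp⟩
  refine summable_of_hasFiniteSupport ((finite_decTuple_le r d).subset ?_)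
  intro f hf i hi
  by_contra! hlt
  apply hf
  change coeff d (fermionicTerm r v f.1) = 0
  rw [fermionicTerm, mul_assoc, coeff_X_pow_mul', if_neg]
  have h1 : f.1 i * (f.1 i + 1) / 2 ≤ ∑ i ∈ Finset.range r, f.1 i * (f.1 i + 1) / 2 :=
    Finset.single_le_sum (f := fun i => f.1 i * (f.1 i + 1) / 2) (fun _ _ => Nat.zero_le _)
      (Finset.mem_range.2 hi)
  have h2 : f.1 i ≤ f.1 i * (f.1 i + 1) / 2 := by
    rw [Nat.le_div_iff_mul_le two_pos]
    nlinarith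
  omega

lemma sum_intervalVec_mul (r a b : ℕ) (hb : b ≤ r) (g : ℕ → ℕ) :
    ∑ t ∈ Finset.range r, intervalVec a b t * g t = ∑ t ∈ Finset.Ico a b, g t := by
  simp only [intervalVec, ite_mul, one_mul, zero_mul]
  rw [← Finset.sum_filter]
  congr 1
  ext t
  simp only [Finset.mem_filter, Finset.mem_range, Finset.mem_Ico]
  omega

lemma fermionicTerm_add (r : ℕ) (v w f : ℕ → ℕ) :
    fermionicTerm r (v + w) f =
      fermionicTerm r v f * X ^ (∑ i ∈ Finset.range r, w i * (f i + 1)) := by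
  simp only [fermionicTerm, Pi.add_apply, add_mul, Finset.sum_add_distrib, pow_add, mul_assoc]

lemma fermionicTerm_add_single (r i : ℕ) (hi : i < r) (v f : ℕ → ℕ) :
    fermionicTerm r (v + intervalVec i (i + 1)) f = fermionicTerm r v f * X ^ (f i + 1) := by
  rw [fermionicTerm_add, sum_intervalVec_mul r _ _ hi]
  simp

/-- Raise the first `i + 1` entries of a tuple by one. -/
def DecTuple.raise {r : ℕ} (i : ℕ) (hi : i < r) (f : DecTuple r) : DecTuple r :=
  ⟨f.1 + intervalVec 0 (i + 1), by
    intro a b hab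
    have := f.2.1 hab
    simp only [Pi.add_apply, intervalVec]
    split_ifs <;> omega, by
    intro a ha
    have := f.2.2 a ha
    simp only [Pi.add_apply, intervalVec]
    split_ifs <;> omega⟩

lemma DecTuple.raise_injective {r : ℕ} (i : ℕ) (hi : i < r) :
    Function.Injective (DecTuple.raise (r := r) i hi) := by
  intro f g h
  apply Subtype.ext
  exact add_right_cancel (congrArg Subtype.val h)

lemma DecTuple.mem_range_raise {r : ℕ} (i : ℕ) (hi : i < r) (f : DecTuple r)
    (h : f.1 (i + 1) < f.1 i) : f ∈ Set.range (DecTuple.raise (r := r) i hi) := by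
  refine ⟨⟨f.1 - intervalVec 0 (i + 1), ?_, ?_⟩, ?_⟩
  · intro a b hab
    have h1 := f.2.1 hab
    simp only [Pi.sub_apply, intervalVec]
    by_cases hb : b ≤ i
    · rw [if_pos (by omega), if_pos (by omega)]
      omega
    · have h2 := f.2.1 (show i + 1 ≤ b by omega)
      by_cases ha : a ≤ i
      · have h3 := f.2.1 ha
        split_ifs <;> omega
      · split_ifs <;> omega
  · intro a ha
    simp [f.2.2 a ha]
  · apply Subtype.ext
    funext a
    simp only [DecTuple.raise, Pi.add_apply, Pi.sub_apply, intervalVec]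
    split_ifs with ha
    · have h3 := f.2.1 (show a ≤ i by omega)
      omega
    · omega

lemma qpT_raise {r : ℕ} (i : ℕ) (hi : i < r) (f : DecTuple r) :
    qpT r (f.raise i hi).1 = qpT r f.1 * (1 - X ^ (f.1 i - f.1 (i + 1) + 1)) := by
  have hmem := Finset.mem_range.2 hi
  rw [qpT, qpT, ← Finset.mul_prod_erase _ _ hmem, ← Finset.mul_prod_erase _ _ hmem]
  have h1 : qp ((f.raise i hi).1 i - (f.raise i hi).1 (i + 1)) =
      qp (f.1 i - f.1 (i + 1)) * (1 - X ^ (f.1 i - f.1 (i + 1) + 1)) := by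
    have hle : f.1 (i + 1) ≤ f.1 i := f.2.1 (Nat.le_succ i)
    have : (f.raise i hi).1 i - (f.raise i hi).1 (i + 1) = f.1 i - f.1 (i + 1) + 1 := by
      simp only [DecTuple.raise, Pi.add_apply, intervalVec]
      simp
      omega
    rw [this, qp, Finset.prod_range_succ, ← qp]
  rw [h1, mul_right_comm]
  congr 2
  refine Finset.prod_congr rfl fun j hj => ?_
  congr 1
  have hj := Finset.ne_of_mem_erase hj
  simp only [DecTuple.raise, Pi.add_apply, intervalVec]
  split_ifs <;> omega

lemma sum_triangle_raise {r : ℕ} (i : ℕ) (hi : i < r) (f : DecTuple r) :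
    ∑ j ∈ Finset.range r, (f.raise i hi).1 j * ((f.raise i hi).1 j + 1) / 2 =
      ∑ j ∈ Finset.range r, f.1 j * (f.1 j + 1) / 2 +
        ∑ j ∈ Finset.range r, intervalVec 0 (i + 1) j * (f.1 j + 1) := by
  rw [← Finset.sum_add_distrib]
  refine Finset.sum_congr rfl fun j _ => ?_
  simp only [DecTuple.raise, Pi.add_apply, intervalVec]
  split_ifs
  · rw [one_mul, ← Nat.add_mul_div_right _ _ two_pos]
    congr 1
    ring
  · simp

lemma sum_mul_raise {r : ℕ} (i : ℕ) (hi : i < r) (v : ℕ → ℕ) (f : DecTuple r) :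
    ∑ j ∈ Finset.range r, v j * ((f.raise i hi).1 j + 1) =
      ∑ j ∈ Finset.range r, v j * (f.1 j + 1) + ∑ j ∈ Finset.range (i + 1), v j := by
  have := sum_intervalVec_mul r 0 (i + 1) hi v
  rw [Finset.range_eq_Ico (a := i + 1), ← this, ← Finset.sum_add_distrib]
  refine Finset.sum_congr rfl fun j _ => ?_
  simp only [DecTuple.raise, Pi.add_apply]
  ring

lemma fermionicTerm_raise {r : ℕ} (i : ℕ) (hi : i + 1 < r) (v : ℕ → ℕ) (f : DecTuple r) :
    fermionicTerm r (v + intervalVec (i + 1) (i + 2)) (f.raise i (by omega)).1 -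
        fermionicTerm r (v + intervalVec i (i + 1)) (f.raise i (by omega)).1 =
      X ^ (∑ j ∈ Finset.range (i + 1), v j) *
        fermionicTerm r (v + intervalVec 0 (i + 2)) f.1 := by
  have hI : intervalVec 0 (i + 2) = intervalVec 0 (i + 1) + intervalVec (i + 1) (i + 2) := by
    funext t
    simp only [intervalVec, Pi.add_apply]
    split_ifs <;> omega
  rw [hI, ← add_assoc, fermionicTerm_add_single r _ hi, fermionicTerm_add_single r _ hi,
    fermionicTerm_add_single r i (by omega), fermionicTerm_add, fermionicTerm, fermionicTerm,
    sum_triangle_raise, sum_mul_raise, qpT_raise, PowerSeries.mul_inv_rev]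
  have h1 : (f.raise i (by omega)).1 (i + 1) = f.1 (i + 1) := by
    simp [DecTuple.raise, intervalVec]
  have h2 : (f.raise i (by omega)).1 i + 1 = f.1 (i + 1) + 1 + (f.1 i - f.1 (i + 1) + 1) := by
    have hle : f.1 (i + 1) ≤ f.1 i := f.2.1 (Nat.le_succ i)
    simp [DecTuple.raise, intervalVec]
    omega
  rw [h1, h2, pow_add X (f.1 (i + 1) + 1)]
  have h3 : (1 - X ^ (f.1 i - f.1 (i + 1) + 1) : ℚ⟦X⟧)⁻¹ *
      (1 - X ^ (f.1 i - f.1 (i + 1) + 1)) = 1 :=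
    PowerSeries.inv_mul_cancel _ (by simp)
  generalize (1 - X ^ (f.1 i - f.1 (i + 1) + 1) : ℚ⟦X⟧)⁻¹ = u at *
  generalize (X ^ (f.1 i - f.1 (i + 1) + 1) : ℚ⟦X⟧) = y at *
  generalize (qpT r f.1)⁻¹ = z
  simp only [pow_add]
  generalize (X : ℚ⟦X⟧) ^ f.1 (i + 1) = x1
  linear_combination (X ^ (∑ j ∈ Finset.range r, f.1 j * (f.1 j + 1) / 2) *
    X ^ (∑ j ∈ Finset.range r, intervalVec 0 (i + 1) j * (f.1 j + 1)) * z *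
    X ^ (∑ j ∈ Finset.range r, v j * (f.1 j + 1)) * X ^ (∑ j ∈ Finset.range (i + 1), v j) *
    x1 * X ^ 1) * h3

lemma fermionic_succ_single (r i : ℕ) (hi : i + 1 < r) (v : ℕ → ℕ) :
    fermionic r (v + intervalVec (i + 1) (i + 2)) =
      fermionic r (v + intervalVec i (i + 1)) +
        X ^ (∑ j ∈ Finset.range (i + 1), v j) * fermionic r (v + intervalVec 0 (i + 2)) := by
  rw [← sub_eq_iff_eq_add', fermionic, fermionic, fermionic,
    ← (summable_fermionicTerm r _).tsum_sub (summable_fermionicTerm r _),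
    ← (summable_fermionicTerm r _).tsum_mul_left]
  simp_rw [← fermionicTerm_raise i hi v]
  symm
  refine (DecTuple.raise_injective i (by omega)).tsum_eq
    (f := fun f : DecTuple r => fermionicTerm r (v + intervalVec (i + 1) (i + 2)) f.1 -
        fermionicTerm r (v + intervalVec i (i + 1)) f.1) ?_
  intro f hf
  apply DecTuple.mem_range_raise
  refine lt_of_le_of_ne (f.2.1 (Nat.le_succ i)) fun h => hf ?_
  change fermionicTerm r (v + intervalVec (i + 1) (i + 2)) f.1 -
    fermionicTerm r (v + intervalVec i (i + 1)) f.1 = 0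
  rw [fermionicTerm_add_single r _ hi, fermionicTerm_add_single r i (by omega), h, sub_self]

/-- Moving the top entry of `[c, c + k) ∪ {c + p}` down to `c + k`. -/
lemma fermionic_interval_add_single (r n c k p : ℕ) (w : ℕ → ℕ) (hw : ∀ t < n, w t = 0)
    (hn : n < r) (hkp : k ≤ p) (hp : c + p < n) :
    fermionic r (w + intervalVec c (c + k) + intervalVec (c + p) (c + p + 1)) =
      fermionic r (w + intervalVec c (c + k + 1)) +
        ∑ l ∈ Finset.Ico k p,
          X ^ k * fermionic r (w + intervalVec c (c + k) + intervalVec 0 (c + l + 2)) := by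
  induction p, hkp using Nat.le_induction with
  | base =>
    rw [Finset.Ico_self, Finset.sum_empty, add_zero, add_assoc]
    congr 2
    funext t
    simp only [intervalVec, Pi.add_apply]
    split_ifs <;> omega
  | succ p hkp ih =>
    have hs : ∑ j ∈ Finset.range (c + p + 1), (w + intervalVec c (c + k)) j = k := by
      have := sum_intervalVec_mul (c + p + 1) c (c + k) (by omega) (fun _ => 1)
      simp only [mul_one, Finset.sum_const, Nat.card_Ico, smul_eq_mul] at this
      simp only [Pi.add_apply, Finset.sum_add_distrib, this]
      rw [Finset.sum_eq_zero fun j hj => hw j (by have := Finset.mem_range.1 hj; omega)]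
      omega
    have := fermionic_succ_single r (c + p) (by omega) (w + intervalVec c (c + k))
    rw [hs, ih (by omega)] at this
    rw [Finset.sum_Ico_succ_top hkp, ← add_assoc (fermionic r _), ← this]
    rfl

/-- Shifting the interval `[c + j + 1, c + k + 2)` down by one. -/
lemma fermionic_interval_shift (r n c k : ℕ) (w : ℕ → ℕ) (hw : ∀ t < n, w t = 0)
    (hn : n < r) (hk : c + k + 1 < n) (j : ℕ) (hj : j ≤ k + 1) :
    fermionic r (w + intervalVec (c + 1) (c + k + 2)) =
      fermionic r (w + intervalVec c (c + j) + intervalVec (c + j + 1) (c + k + 2)) +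
        ∑ l ∈ Finset.range j,
          X ^ l * fermionic r (w + intervalVec c (c + l) + intervalVec 0 (c + k + 2)) := by
  induction j with
  | zero =>
    rw [Finset.sum_range_zero, add_zero]
    congr 2
    funext t
    simp only [intervalVec, Pi.add_apply]
    split_ifs <;> omega
  | succ j ih =>
    set v := w + intervalVec c (c + j) + intervalVec (c + j + 2) (c + k + 2) with hv
    have hs : ∑ l ∈ Finset.range (c + j + 1), v l = j := by
      have := sum_intervalVec_mul (c + j + 1) c (c + j) (by omega) (fun _ => 1)
      simp only [mul_one, Finset.sum_const, Nat.card_Ico, smul_eq_mul] at this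
      rw [← (show c + j - c = j by omega), ← this]
      refine Finset.sum_congr (by congr 1; omega) fun l hl => ?_
      have hl := Finset.mem_range.1 hl
      simp only [hv, Pi.add_apply, hw l (by omega), intervalVec]
      split_ifs <;> omega
    have key := fermionic_succ_single r (c + j) (by omega) v
    have e1 : v + intervalVec (c + j + 1) (c + j + 2) =
        w + intervalVec c (c + j) + intervalVec (c + j + 1) (c + k + 2) := by
      funext t
      simp only [hv, intervalVec, Pi.add_apply]
      split_ifs <;> omega
    have e2 : v + intervalVec (c + j) (c + j + 1) =
        w + intervalVec c (c + (j + 1)) + intervalVec (c + (j + 1) + 1) (c + k + 2) := by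
      funext t
      simp only [hv, intervalVec, Pi.add_apply]
      split_ifs <;> omega
    have e3 : v + intervalVec 0 (c + j + 2) =
        w + intervalVec c (c + j) + intervalVec 0 (c + k + 2) := by
      funext t
      simp only [hv, intervalVec, Pi.add_apply]
      split_ifs <;> omega
    rw [e1, e2, e3, hs] at key
    rw [ih (by omega), key, Finset.sum_range_succ]
    ring

lemma sum_fermionic_interval (r c m : ℕ) (w : ℕ → ℕ) (hw : ∀ t < c + m + 1, w t = 0)
    (hn : c + m + 1 < r) :
    ∑ k ∈ Finset.range m, fermionic r (w + intervalVec (c + 1) (c + k + 2)) =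
      ∑ k ∈ Finset.range m,
        fermionic r (w + intervalVec c (c + k) + intervalVec (c + m) (c + m + 1)) := by
  have h1 : ∀ k ∈ Finset.range m, fermionic r (w + intervalVec (c + 1) (c + k + 2)) =
      fermionic r (w + intervalVec c (c + k + 1)) + ∑ l ∈ Finset.range (k + 1),
          X ^ l * fermionic r (w + intervalVec c (c + l) + intervalVec 0 (c + k + 2)) := by
    intro k hk
    have hk := Finset.mem_range.1 hk
    rw [fermionic_interval_shift r (c + m + 1) c k w hw hn (by omega) (k + 1) le_rfl]
    congr 2
    funext t
    simp only [intervalVec, Pi.add_apply]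
    split_ifs <;> omega
  have h2 : ∀ k ∈ Finset.range m,
      fermionic r (w + intervalVec c (c + k) + intervalVec (c + m) (c + m + 1)) =
      fermionic r (w + intervalVec c (c + k + 1)) + ∑ l ∈ Finset.Ico k m,
          X ^ k * fermionic r (w + intervalVec c (c + k) + intervalVec 0 (c + l + 2)) := by
    intro k hk
    have hk := Finset.mem_range.1 hk
    exact fermionic_interval_add_single r (c + m + 1) c k m w hw hn (by omega) (by omega)
  rw [Finset.sum_congr rfl h1, Finset.sum_congr rfl h2, Finset.sum_add_distrib,
    Finset.sum_add_distrib]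
  congr 1
  refine Finset.sum_comm' fun k l => ?_
  simp only [Finset.mem_range, Finset.mem_Ico]
  omega

/-- The indicator function of `{n - 1, n - 3, …, n - 2 k + 1}`. -/
def alternatingVec (n k : ℕ) : ℕ → ℕ :=
  fun t => ∑ j ∈ Finset.range k, intervalVec (n - 1 - 2 * j) (n - 1 - 2 * j + 1) t

lemma alternatingVec_succ (n k : ℕ) :
    alternatingVec n (k + 1) = intervalVec (n - 1) (n - 1 + 1) + alternatingVec (n - 2) k := by
  funext t
  rw [alternatingVec, Finset.sum_range_succ', add_comm, Pi.add_apply, alternatingVec]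
  congr 1
  refine Finset.sum_congr rfl fun j _ => ?_
  rw [show n - 1 - 2 * (j + 1) = n - 2 - 1 - 2 * j by omega]

lemma sum_fermionic_eq (r m : ℕ) : ∀ (n : ℕ) (w : ℕ → ℕ), m ≤ n → n < r →
    (∀ t < n, w t = 0) →
    ∑ k ∈ Finset.range (m + 1), fermionic r (w + intervalVec (n - m) (n - m + k)) =
      ∑ k ∈ Finset.range (min m (n + 1 - m) + 1), fermionic r (w + alternatingVec n k) := by
  have h0 : ∀ a, intervalVec a (a + 0) = 0 := by
    intro a
    funext t
    simp only [intervalVec, Pi.zero_apply]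
    split_ifs <;> omega
  have h0' : ∀ n, alternatingVec n 0 = 0 := fun n => rfl
  induction m with
  | zero =>
    intro n w _ _ _
    simp only [Nat.zero_min, zero_add, Finset.sum_range_one, h0, h0']
  | succ m ih =>
    intro n w hmn hn hw
    rw [Finset.sum_range_succ', h0, show min (m + 1) (n + 1 - (m + 1)) =
      min m (n - 1 - m) + 1 by omega, Finset.sum_range_succ' _ (_ + 1), h0']
    congr 1
    simp_rw [alternatingVec_succ, ← add_assoc]
    rcases Nat.eq_or_lt_of_le hmn with rfl | hlt
    · have := fermionic_interval_add_single r (m + 1) 0 0 m w hw hn (Nat.zero_le _) (by omega)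
      rw [h0, ← Finset.range_eq_Ico] at this
      simp only [zero_add, pow_zero, one_mul, add_zero] at this
      simp only [Nat.add_sub_cancel, Nat.sub_self, Nat.min_zero, Finset.sum_range_one, zero_add,
        h0', add_zero]
      rw [Finset.sum_range_succ', this, add_comm]
    · obtain ⟨c, rfl⟩ := Nat.exists_eq_add_of_lt hlt
      have := sum_fermionic_interval r c (m + 1) w (fun t ht => hw t (by omega)) (by omega)
      have e := ih (c + m) (w + intervalVec (c + m + 1) (c + m + 2)) (by omega) (by omega) (by
        intro t ht
        simp only [Pi.add_apply, hw t (by omega), intervalVec]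
        split_ifs <;> omega)
      rw [show c + m - m = c by omega] at e
      rw [show m + 1 + c + 1 - (m + 1) = c + 1 by omega,
        show m + 1 + c + 1 - 1 = c + m + 1 by omega,
        show m + 1 + c + 1 - 2 = c + m by omega, ← e]
      refine Eq.trans (Finset.sum_congr rfl fun k _ => ?_) (this.trans
        (Finset.sum_congr rfl fun k _ => ?_))
      · rw [show c + 1 + k + 1 = c + k + 2 by omega]
      · rw [add_right_comm]
        rfl

lemma tsum_eq_sum_fermionic (r K : ℕ) (v : ℕ → ℕ → ℕ) (E : ℕ → (ℕ → ℕ) → ℕ)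
    (h0 : v 0 = 0)
    (hE : ∀ i < K, ∀ f : ℕ → ℕ, ∑ t ∈ Finset.range r, v (i + 1) t * (f t + 1) = E i f) :
    ∑' f : DecTuple r,
        (X : ℚ⟦X⟧) ^ (∑ i ∈ Finset.range r, f.1 i * (f.1 i + 1) / 2) * (qpT r f.1)⁻¹ *
          (1 + ∑ i ∈ Finset.range K, (X : ℚ⟦X⟧) ^ E i f.1) =
      ∑ k ∈ Finset.range (K + 1), fermionic r (v k) := by
  simp only [fermionic]
  rw [← Summable.tsum_finsetSum fun k _ => summable_fermionicTerm r (v k)]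
  congr 1
  funext f
  rw [Finset.sum_range_succ', mul_add, Finset.mul_sum, add_comm]
  congr 1
  · refine Finset.sum_congr rfl fun i hi => ?_
    rw [fermionicTerm, hE i (Finset.mem_range.1 hi)]
  · simp [fermionicTerm, h0]

/-- Proposition `main proposition`: the two fermionic sums agree, with
`m' = min(m, r-m)`  (`f.1 t` is `λ_{t+1}`). -/
theorem stmt4 (r m : ℕ) (hr : 1 ≤ r) (hm : m ≤ r - 1) :
    (∑' f : DecTuple r,
        (X : ℚ⟦X⟧) ^ (∑ i ∈ Finset.range r, f.1 i * (f.1 i + 1) / 2) * (qpT r f.1)⁻¹ *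
          (1 + ∑ i ∈ Finset.range m,
            (X : ℚ⟦X⟧) ^ ∑ j ∈ Finset.range (i + 1), (f.1 (r - m - 1 + j) + 1))) =
      ∑' f : DecTuple r,
        (X : ℚ⟦X⟧) ^ (∑ i ∈ Finset.range r, f.1 i * (f.1 i + 1) / 2) * (qpT r f.1)⁻¹ *
          (1 + ∑ i ∈ Finset.range (min m (r - m)),
            (X : ℚ⟦X⟧) ^ ∑ j ∈ Finset.range (i + 1), (f.1 (r - 2 - 2 * j) + 1)) := by
  rw [tsum_eq_sum_fermionic r m (fun k => intervalVec (r - 1 - m) (r - 1 - m + k))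
      (fun i f => ∑ j ∈ Finset.range (i + 1), (f (r - m - 1 + j) + 1)),
    tsum_eq_sum_fermionic r (min m (r - m)) (fun k => alternatingVec (r - 1) k)
      (fun i f => ∑ j ∈ Finset.range (i + 1), (f (r - 2 - 2 * j) + 1))]
  · have := sum_fermionic_eq r m (r - 1) 0 hm (by omega) (fun _ _ => rfl)
    simp only [zero_add] at this
    rwa [Nat.sub_add_cancel hr] at this
  · rfl
  · intro i hi f
    simp only [alternatingVec, Finset.sum_mul]
    rw [Finset.sum_comm]
    refine Finset.sum_congr rfl fun j hj => ?_
    have hj := Finset.mem_range.1 hj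
    rw [sum_intervalVec_mul r _ _ (by omega)]
    simp [show r - 1 - 1 = r - 2 by omega]
  · funext t
    simp only [intervalVec, Pi.zero_apply]
    split_ifs <;> omega
  · intro i hi f
    rw [sum_intervalVec_mul r _ _ (by omega), Finset.sum_Ico_eq_sum_range, Nat.add_sub_cancel_left,
      show r - 1 - m = r - m - 1 by omega]
end
end

section
/- Let r ≥ 1, let l ≤ r and let s be an integer with 0 ≤ s ≤ (l−2)/2, and let P ∈ ℤ[x_l, …, x_r, q] be any polynomial not involving x_1, …, x_{l−1}. Then (1 + q x_l) (∏_{i=0}^{s} x_{l−1−2i}) · P ≈ (1 + q x_{l−2s−2}) (∏_{i=0}^{s} x_{l−2i}) · P, where by convention x_0 = 0. -/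
open PowerSeries

noncomputable section

/-- The variable `x_j` (1-indexed, `1 ≤ j ≤ r`) of `ℤ[x_1,…,x_r,q]`, with the
conventions `x_j = 0` for `j < 1` and `x_j = 1` for `j > r`. -/
def xv (r j : ℕ) : MvPolynomial (Fin (r + 1)) ℤ :=
  if h : 1 ≤ j ∧ j ≤ r then MvPolynomial.X ⟨j - 1, by omega⟩
  else if j = 0 then 0 else 1

/-- The variable `q` of `ℤ[x_1,…,x_r,q]`. -/
def qv (r : ℕ) : MvPolynomial (Fin (r + 1)) ℤ := MvPolynomial.X (Fin.last r)

/-- Evaluation of `P ∈ ℤ[x_1,…,x_r,q]` at `x_j = q^{λ_j}` and `q = X` in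
`ℚ⟦X⟧`; here `f` is the 0-indexed tuple `(λ_1, …, λ_r)`. -/
def pEval (r : ℕ) (f : ℕ → ℕ) (P : MvPolynomial (Fin (r + 1)) ℤ) : ℚ⟦X⟧ :=
  MvPolynomial.aeval
    (fun i : Fin (r + 1) => if (i : ℕ) < r then (X : ℚ⟦X⟧) ^ f i else X) P

/-- The relation `P ≈ Q`:
`Σ_{λ_1 ≥ … ≥ λ_r ≥ 0} q^{Σ (λ_i²+λ_i)/2}/(q)_λ · (P(q^{λ_1},…,q^{λ_r},q) - Q(q^{λ_1},…,q^{λ_r},q)) = 0`. -/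
def papprox (r : ℕ) (P Q : MvPolynomial (Fin (r + 1)) ℤ) : Prop :=
  ∑' f : DecTuple r,
    (X : ℚ⟦X⟧) ^ (∑ i ∈ Finset.range r, f.1 i * (f.1 i + 1) / 2) * (qpT r f.1)⁻¹ *
      (pEval r f.1 P - pEval r f.1 Q) = 0

instance : IsTopologicalAddGroup ℚ⟦X⟧ :=
  inferInstanceAs (IsTopologicalAddGroup ((Unit →₀ ℕ) → ℚ))

/-- The weight `q^{Σ (λ_i²+λ_i)/2}/(q)_λ` of a tuple. -/
def weight (r : ℕ) (f : ℕ → ℕ) : ℚ⟦X⟧ :=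
  X ^ (∑ i ∈ Finset.range r, f i * (f i + 1) / 2) * (qpT r f)⁻¹

lemma finite_setOf_sum_triangle_le (r n : ℕ) :
    {f : DecTuple r | ∑ i ∈ Finset.range r, f.1 i * (f.1 i + 1) / 2 ≤ n}.Finite := by
  have hinj : Function.Injective (fun (f : DecTuple r) (i : Fin r) => f.1 i) := by
    intro f g h
    apply Subtype.ext
    funext i
    by_cases hi : i < r
    · exact congrFun h ⟨i, hi⟩
    · rw [f.2.2 i (by omega), g.2.2 i (by omega)]
  refine ((Set.finite_Iic (fun _ : Fin r => n)).preimage hinj.injOn).subset ?_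
  intro f hf i
  have h1 : f.1 i * (f.1 i + 1) / 2 ≤ n :=
    (Finset.single_le_sum (f := fun i => f.1 i * (f.1 i + 1) / 2) (fun _ _ => Nat.zero_le _)
      (Finset.mem_range.2 i.2)).trans hf
  have h2 : f.1 i ≤ f.1 i * (f.1 i + 1) / 2 := by
    rw [Nat.le_div_iff_mul_le (by norm_num)]
    rcases Nat.eq_zero_or_pos (f.1 i) with h | h
    · simp [h]
    · exact Nat.mul_le_mul_left _ (by omega)
  exact h2.trans h1

lemma summable_weight_mul (r : ℕ) (G : DecTuple r → ℚ⟦X⟧) :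
    Summable fun f : DecTuple r => weight r f.1 * G f := by
  refine Pi.summable.2 fun d => ?_
  refine summable_of_hasFiniteSupport ((finite_setOf_sum_triangle_le r (d ())).subset ?_)
  intro f hf
  by_contra hlt
  rw [Set.mem_ofPred_eq] at hlt
  apply hf
  have hd : d = Finsupp.single () (d ()) := by ext; simp
  have hc : coeff (d ()) (weight r f.1 * G f) = 0 := by
    rw [weight, mul_assoc, coeff_X_pow_mul', if_neg hlt]
  rw [coeff, ← hd] at hc
  exact hc

lemma constantCoeff_qp_ne_zero (n : ℕ) : constantCoeff (qp n) ≠ 0 := by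
  simp [qp, map_prod]

lemma constantCoeff_qpT_ne_zero (r : ℕ) (f : ℕ → ℕ) : constantCoeff (qpT r f) ≠ 0 := by
  rw [qpT, map_prod]
  exact Finset.prod_ne_zero_iff.2 fun _ _ => constantCoeff_qp_ne_zero _

/-- `q^{λ_{j-1}}` in terms of the 0-indexed tuple, with the convention `λ_{-1} = ∞`. -/
def prevPow (f : ℕ → ℕ) (j : ℕ) : ℚ⟦X⟧ := if j = 0 then 0 else X ^ f (j - 1)

lemma sum_triangle_update (r j : ℕ) (hj : j < r) (f : ℕ → ℕ) :
    ∑ i ∈ Finset.range r, Function.update f j (f j + 1) i *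
        (Function.update f j (f j + 1) i + 1) / 2 =
      ∑ i ∈ Finset.range r, f i * (f i + 1) / 2 + (f j + 1) := by
  have h : f j + 1 = ∑ i ∈ Finset.range r, if i = j then f j + 1 else 0 := by
    simp [hj]
  conv_rhs => rw [h]
  rw [← Finset.sum_add_distrib]
  refine Finset.sum_congr rfl fun i _ => ?_
  by_cases hi : i = j
  · subst hi
    have : (f i + 1) * (f i + 1 + 1) = f i * (f i + 1) + 2 * (f i + 1) := by ring
    simp only [Function.update_self, if_true, this]
    omega
  · simp [hi]

lemma qpT_update (r j : ℕ) (hj : j < r) (f : ℕ → ℕ) (h1 : f (j + 1) ≤ f j)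
    (h2 : j = 0 ∨ f j < f (j - 1)) :
    qpT r (Function.update f j (f j + 1)) *
        (1 - if j = 0 then 0 else X ^ (f (j - 1) - f j)) =
      qpT r f * (1 - X ^ (f j + 1 - f (j + 1))) := by
  have e1 : (1 - if j = 0 then 0 else X ^ (f (j - 1) - f j) : ℚ⟦X⟧) =
      ∏ i ∈ Finset.range r, if i + 1 = j then 1 - X ^ (f i - f (i + 1)) else 1 := by
    rcases j with _ | j
    · simp
    · simp [show j < r by omega]
  have e2 : (1 - X ^ (f j + 1 - f (j + 1)) : ℚ⟦X⟧) =
      ∏ i ∈ Finset.range r, if i = j then 1 - X ^ (f i + 1 - f (i + 1)) else 1 := by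
    simp [hj]
  rw [e1, e2, qpT, qpT, ← Finset.prod_mul_distrib, ← Finset.prod_mul_distrib]
  refine Finset.prod_congr rfl fun i _ => ?_
  by_cases hi : i = j
  · subst hi
    obtain ⟨k, hk⟩ := Nat.exists_eq_add_of_le h1
    rw [Function.update_self, Function.update_of_ne (by omega), if_neg (by omega), if_pos rfl,
      show f i + 1 - f (i + 1) = k + 1 by omega, show f i - f (i + 1) = k by omega, qp_succ,
      mul_one]
  · rw [Function.update_of_ne hi, if_neg hi, mul_one]
    by_cases hi' : i + 1 = j
    · subst hi'
      have h3 : f (i + 1) < f i := by simpa using h2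
      obtain ⟨k, hk⟩ := Nat.exists_eq_add_of_lt h3
      rw [Function.update_self, if_pos rfl, show f i - f (i + 1) = k + 1 by omega,
        show f i - (f (i + 1) + 1) = k by omega, qp_succ]
    · rw [Function.update_of_ne hi', if_neg hi', mul_one]

lemma weight_update (r j : ℕ) (hj : j < r) (f : ℕ → ℕ) (h1 : f (j + 1) ≤ f j)
    (h2 : j = 0 ∨ f j < f (j - 1)) :
    weight r (Function.update f j (f j + 1)) * (X ^ f (j + 1) - X ^ (f j + 1)) =
      weight r f * (X ^ f (j + 1) * (X ^ (f j + 1) - X * prevPow f j)) := by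
  have hq := qpT_update r j hj f h1 h2
  have e1 : (X ^ f (j + 1) - X ^ (f j + 1) : ℚ⟦X⟧) =
      X ^ f (j + 1) * (1 - X ^ (f j + 1 - f (j + 1))) := by
    rw [mul_sub, mul_one, ← pow_add, Nat.add_sub_cancel' (by omega)]
  have e2 : (X ^ (f j + 1) - X * prevPow f j : ℚ⟦X⟧) =
      X ^ (f j + 1) * (1 - if j = 0 then 0 else X ^ (f (j - 1) - f j)) := by
    rw [prevPow]
    split_ifs with h
    · simp
    · rw [mul_sub, mul_one, ← pow_add, ← pow_succ']
      congr 2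
      omega
  rw [e1, e2, weight, weight, sum_triangle_update r j hj, pow_add]
  have i1 := PowerSeries.mul_inv_cancel _ (constantCoeff_qpT_ne_zero r f)
  have i2 := PowerSeries.mul_inv_cancel _ (constantCoeff_qpT_ne_zero r (Function.update f j (f j + 1)))
  generalize (1 - if j = 0 then 0 else X ^ (f (j - 1) - f j) : ℚ⟦X⟧) = u at *
  generalize (1 - X ^ (f j + 1 - f (j + 1)) : ℚ⟦X⟧) = v at *
  generalize qpT r (Function.update f j (f j + 1)) = a at *
  generalize qpT r f = b at *
  have key : a⁻¹ * v = b⁻¹ * u := by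
    linear_combination (-(a⁻¹ * b⁻¹)) * hq - a⁻¹ * v * i1 + b⁻¹ * u * i2
  linear_combination (X ^ (∑ i ∈ Finset.range r, f i * (f i + 1) / 2) * X ^ (f j + 1) *
    X ^ f (j + 1)) * key

/-- Changing the entry `j` of a decreasing tuple to a value between its neighbours. -/
def DecTuple.update {r : ℕ} (f : DecTuple r) (j b : ℕ) (hj : j < r) (h1 : f.1 (j + 1) ≤ b)
    (h2 : j = 0 ∨ b ≤ f.1 (j - 1)) : DecTuple r :=
  ⟨Function.update f.1 j b, by
    refine ⟨antitone_nat_of_succ_le fun n => ?_, fun i hi => ?_⟩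
    · have h3 := f.2.1 (Nat.le_succ n)
      simp only [Function.update_apply]
      split_ifs with ha hb hb
      · omega
      · subst ha; simpa using h2
      · subst hb; exact h1
      · exact h3
    · rw [Function.update_of_ne (by omega), f.2.2 i hi]⟩

/-- The summation over the single entry `j` telescopes. -/
lemma hasSum_transformation (r j : ℕ) (hj : j < r) (G : (ℕ → ℕ) → ℚ⟦X⟧)
    (hG : ∀ f b, G (Function.update f j b) = G f) :
    HasSum (fun f : DecTuple r => weight r f.1 *
      (((1 + X * X ^ f.1 (j + 1)) * X ^ f.1 j -
        (1 + X * prevPow f.1 j) * X ^ f.1 (j + 1)) * G f.1)) 0 := by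
  set A : DecTuple r → ℚ⟦X⟧ := fun f => weight r f.1 *
    (X ^ f.1 (j + 1) * (X ^ (f.1 j + 1) - X * prevPow f.1 j) * G f.1) with hA
  set B : DecTuple r → ℚ⟦X⟧ := fun f => weight r f.1 *
    ((X ^ f.1 (j + 1) - X ^ f.1 j) * G f.1) with hB
  have hdec : ∀ f : DecTuple r, f.1 (j + 1) ≤ f.1 j := fun f => f.2.1 (Nat.le_succ j)
  have hprev : ∀ f : DecTuple r, A f ≠ 0 → j = 0 ∨ f.1 j < f.1 (j - 1) := by
    intro f hf
    by_contra! h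
    apply hf
    have : f.1 (j - 1) = f.1 j := le_antisymm h.2 (f.2.1 (Nat.sub_le j 1))
    simp [hA, prevPow, h.1, this, pow_succ']
  have hshift : ∀ (f : DecTuple r) (h1 : f.1 (j + 1) ≤ f.1 j + 1)
      (h2 : j = 0 ∨ f.1 j + 1 ≤ f.1 (j - 1)), B (f.update j (f.1 j + 1) hj h1 h2) = A f := by
    intro f h1 h2
    have hw := weight_update r j hj f.1 (hdec f) h2
    simp only [hA, hB, DecTuple.update, hG, Function.update_self,
      Function.update_of_ne (Nat.succ_ne_self j)]
    rw [← mul_assoc, hw, mul_assoc]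
  have hsum : ∑' f, B f = ∑' f, A f := by
    refine tsum_eq_tsum_of_ne_zero_bij
      (fun f : Function.support A => f.1.update j (f.1.1 j + 1) hj
        ((hdec f.1).trans (Nat.le_succ _)) (hprev f.1 f.2)) ?_ ?_ ?_
    · intro f g h
      have h' := congrArg Subtype.val h
      simp only [DecTuple.update] at h'
      apply Subtype.ext
      apply Subtype.ext
      funext i
      have hi := congrFun h' i
      by_cases hij : i = j
      · subst hij; simpa using hi
      · simpa [hij] using hi
    · intro f hf
      have hne : f.1 (j + 1) ≠ f.1 j := by
        intro h
        apply hf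
        simp [hB, h]
      have hlt : f.1 (j + 1) < f.1 j := lt_of_le_of_ne (hdec f) hne
      have hle : j = 0 ∨ f.1 j ≤ f.1 (j - 1) := Or.inr (f.2.1 (Nat.sub_le j 1))
      let g : DecTuple r := f.update j (f.1 j - 1) hj (by omega) (by omega)
      have hgj : g.1 j = f.1 j - 1 := Function.update_self ..
      have hgi : ∀ i, i ≠ j → g.1 i = f.1 i := fun i hi => Function.update_of_ne hi ..
      have hg1 : g.1 (j + 1) ≤ g.1 j + 1 := (hdec g).trans (Nat.le_succ _)
      have hg2 : j = 0 ∨ g.1 j + 1 ≤ g.1 (j - 1) := by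
        rcases Nat.eq_zero_or_pos j with h | h
        · exact Or.inl h
        · rw [hgj, hgi (j - 1) (by omega)]
          omega
      have hgf : g.update j (g.1 j + 1) hj hg1 hg2 = f := by
        apply Subtype.ext
        funext i
        by_cases hij : i = j
        · subst hij
          simp only [DecTuple.update, Function.update_self, hgj]
          omega
        · simp only [DecTuple.update, Function.update_of_ne hij, hgi i hij]
      have hgA : A g ≠ 0 := by
        rw [← hshift g hg1 hg2, hgf]
        exact hf
      exact ⟨⟨g, hgA⟩, hgf⟩
    · intro f
      exact hshift f.1 _ _
  have hAB := (summable_weight_mul r _ : Summable A).hasSum.sub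
    (summable_weight_mul r _ : Summable B).hasSum
  rw [hsum, sub_self] at hAB
  refine (congrArg (HasSum · 0) (funext fun f => ?_)).mpr hAB
  ring

lemma pEval_mul (r : ℕ) (f : ℕ → ℕ) (P Q : MvPolynomial (Fin (r + 1)) ℤ) :
    pEval r f (P * Q) = pEval r f P * pEval r f Q := map_mul _ _ _

lemma pEval_one_add_qv_mul (r : ℕ) (f : ℕ → ℕ) (P : MvPolynomial (Fin (r + 1)) ℤ) :
    pEval r f (1 + qv r * P) = 1 + X * pEval r f P := by
  simp [pEval, qv]

lemma pEval_prod {ι : Type*} (r : ℕ) (f : ℕ → ℕ) (t : Finset ι)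
    (P : ι → MvPolynomial (Fin (r + 1)) ℤ) :
    pEval r f (∏ i ∈ t, P i) = ∏ i ∈ t, pEval r f (P i) := map_prod _ _ _

lemma pEval_xv_succ (r : ℕ) (f : ℕ → ℕ) (j : ℕ) (hj : j < r) :
    pEval r f (xv r (j + 1)) = X ^ f j := by
  rw [xv, dif_pos (by omega)]
  simp [pEval, hj]

lemma pEval_xv_eq_prevPow (r : ℕ) (f : ℕ → ℕ) (j : ℕ) (hj : j ≤ r) :
    pEval r f (xv r j) = prevPow f j := by
  rcases j with _ | j
  · rw [xv, dif_neg (by omega), if_pos rfl, pEval, map_zero, prevPow, if_pos rfl]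
  · rw [pEval_xv_succ r f j hj]
    simp [prevPow]

lemma pEval_update_of_notMem_vars (r j b : ℕ) (f : ℕ → ℕ) (P : MvPolynomial (Fin (r + 1)) ℤ)
    (h : ∀ i : Fin (r + 1), (i : ℕ) = j → i ∉ P.vars) :
    pEval r (Function.update f j b) P = pEval r f P := by
  refine MvPolynomial.eval₂Hom_congr' rfl (fun i hi _ => ?_) rfl
  rw [Function.update_of_ne fun hij => h i hij hi]

lemma pEval_xv_update (r j b i : ℕ) (f : ℕ → ℕ) (hir : i ≤ r) (hij : i ≠ j + 1) :
    pEval r (Function.update f j b) (xv r i) = pEval r f (xv r i) := by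
  rw [pEval_xv_eq_prevPow r _ i hir, pEval_xv_eq_prevPow r _ i hir, prevPow, prevPow]
  split_ifs with h
  · rfl
  · rw [Function.update_of_ne (by omega)]

/-- The polynomials interpolating between the two sides of the transformation. -/
def interpolant (r l s : ℕ) (P : MvPolynomial (Fin (r + 1)) ℤ) (t : ℕ) :
    MvPolynomial (Fin (r + 1)) ℤ :=
  (1 + qv r * xv r (l - 2 * t)) * ((∏ i ∈ Finset.range t, xv r (l - 2 * i)) *
    ∏ i ∈ Finset.Ico t (s + 1), xv r (l - 1 - 2 * i)) * P

lemma hasSum_interpolant_sub (r l s t : ℕ) (hl : l ≤ r) (hs : 2 * s + 2 ≤ l) (ht : t ≤ s)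
    (P : MvPolynomial (Fin (r + 1)) ℤ)
    (hP : ∀ j : Fin (r + 1), (j : ℕ) + 1 < l → j ∉ P.vars) :
    HasSum (fun f : DecTuple r => weight r f.1 *
      (pEval r f.1 (interpolant r l s P t) - pEval r f.1 (interpolant r l s P (t + 1)))) 0 := by
  obtain ⟨j, hj⟩ : ∃ j, l = 2 * t + j + 2 := ⟨l - 2 * t - 2, by omega⟩
  have key := hasSum_transformation r j (by omega) (fun f => pEval r f
    ((∏ i ∈ Finset.range t, xv r (l - 2 * i)) *
      (∏ i ∈ Finset.Ico (t + 1) (s + 1), xv r (l - 1 - 2 * i)) * P)) (by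
    intro f b
    simp only [pEval_mul, pEval_prod]
    refine congrArg₂ _ (congrArg₂ _ ?_ ?_) ?_
    · refine Finset.prod_congr rfl fun i hi => pEval_xv_update _ _ _ _ _ (by omega) ?_
      have := Finset.mem_range.1 hi
      omega
    · refine Finset.prod_congr rfl fun i hi => pEval_xv_update _ _ _ _ _ (by omega) ?_
      have := Finset.mem_Ico.1 hi
      omega
    · exact pEval_update_of_notMem_vars _ _ _ _ _ fun i hi => hP i (by omega))
  convert key using 3 with f
  rw [interpolant, interpolant, Finset.prod_range_succ,
    Finset.prod_eq_prod_Ico_succ_bot (show t < s + 1 by omega),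
    show l - 2 * t = j + 1 + 1 by omega, show l - 1 - 2 * t = j + 1 by omega,
    show l - 2 * (t + 1) = j by omega]
  simp only [pEval_mul, pEval_one_add_qv_mul, pEval_xv_succ r f.1 j (by omega),
    pEval_xv_succ r f.1 (j + 1) (by omega), pEval_xv_eq_prevPow r f.1 j (by omega)]
  ring

/-- Lemma `second transformation`:
`(1 + q x_l) (∏_{i=0}^{s} x_{l-1-2i}) P ≈ (1 + q x_{l-2s-2}) (∏_{i=0}^{s} x_{l-2i}) P`
for `0 ≤ s ≤ (l-2)/2`, `l ≤ r`, and `P` not involving `x_1, …, x_{l-1}`. -/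
theorem stmt7 (r l s : ℕ) (hr : 1 ≤ r) (hl : l ≤ r) (hs : 2 * s + 2 ≤ l)
    (P : MvPolynomial (Fin (r + 1)) ℤ)
    (hP : ∀ j : Fin (r + 1), (j : ℕ) + 1 < l → j ∉ P.vars) :
    papprox r
      ((1 + qv r * xv r l) * (∏ i ∈ Finset.range (s + 1), xv r (l - 1 - 2 * i)) * P)
      ((1 + qv r * xv r (l - 2 * s - 2)) *
        (∏ i ∈ Finset.range (s + 1), xv r (l - 2 * i)) * P) := by
  have h := hasSum_sum (s := Finset.range (s + 1)) fun t ht =>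
    hasSum_interpolant_sub r l s t hl hs (Nat.lt_succ_iff.1 (Finset.mem_range.1 ht)) P hP
  rw [Finset.sum_const_zero] at h
  refine Eq.trans (tsum_congr fun f => ?_) h.tsum_eq
  rw [← Finset.mul_sum, Finset.sum_range_sub']
  simp [interpolant, weight, Nat.mul_add, Nat.sub_sub]
end
end
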